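/- arXiv:1406.4909 — 3 statements merged into one kernel-verified Lean document; each statement's English description precedes it below -/
import Mathlib

section
/- Every homeomorphism of a metric space with the large periods property is topologically mixing. -/
open Metric Filter

/-- The orbit `{f^k p : k ∈ ℤ}` of a point `p` under a homeomorphism `f`. -/
def orbitZ {X : Type*} [TopologicalSpace X] (f : X ≃ₜ X) (p : X) : Set X :=
  {x | ∃ k : ℤ, (f.toEquiv ^ k) p = x}

/-- A set `S` is `ε`-dense in `X` if every point of `X` lies within distance `ε`
of some point of `S`. -/
def epsDense {X : Type*} [MetricSpace X] (S : Set X) (ε : ℝ) : Prop :=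
  ∀ x : X, ∃ y ∈ S, dist x y ≤ ε

/-- A homeomorphism `f` has the large periods property: for every `ε > 0` there is
`N₀` such that for every `n ≥ N₀` there is a point fixed by `f^n` whose orbit is
`ε`-dense in `X`. -/
def LargePeriods {X : Type*} [MetricSpace X] (f : X ≃ₜ X) : Prop :=
  ∀ ε > (0 : ℝ), ∃ N₀ : ℕ, ∀ n ≥ N₀, ∃ p : X,
    (⇑f)^[n] p = p ∧ epsDense (orbitZ f p) ε

theorem iterate_eq_self_of_mem_orbitZ {X : Type*} [TopologicalSpace X] {f : X ≃ₜ X} {p q : X} {n : ℕ}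
    (hp : (⇑f)^[n] p = p) (hq : q ∈ orbitZ f p) : (⇑f)^[n] q = q := by
  obtain ⟨k, rfl⟩ := hq
  have hpow : ∀ x, (⇑f)^[n] x = (f.toEquiv ^ n : Equiv.Perm X) x := fun x => by
    rw [Equiv.Perm.coe_pow]; rfl
  rw [hpow] at hp ⊢
  rw [← Equiv.Perm.mul_apply, ((Commute.refl f.toEquiv).pow_left n |>.zpow_right k).eq,
    Equiv.Perm.mul_apply, hp]

theorem exists_iterate_eq_or_of_mem_orbitZ {X : Type*} [TopologicalSpace X] {f : X ≃ₜ X} {p y z : X}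
    (hy : y ∈ orbitZ f p) (hz : z ∈ orbitZ f p) :
    ∃ j : ℕ, (⇑f)^[j] y = z ∨ (⇑f)^[j] z = y := by
  obtain ⟨a, rfl⟩ := hy
  obtain ⟨b, rfl⟩ := hz
  have hpow : ∀ (j : ℕ) x, (⇑f)^[j] x = (f.toEquiv ^ (j : ℤ) : Equiv.Perm X) x := fun j x => by
    rw [zpow_natCast, Equiv.Perm.coe_pow]; rfl
  refine ⟨(b - a).natAbs, ?_⟩
  simp only [hpow, ← Equiv.Perm.mul_apply, ← zpow_add]
  rcases le_total a b with hab | hab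
  · left
    rw [show ((b - a).natAbs : ℤ) + a = b by omega]
  · right
    rw [show ((b - a).natAbs : ℤ) + b = a by omega]

theorem epsDense.exists_mem_of_ball_subset {X : Type*} [MetricSpace X] {S U : Set X} {ε r : ℝ} {x : X}
    (hS : epsDense S ε) (hr : ε < r) (hU : ball x r ⊆ U) : ∃ y ∈ S, y ∈ U := by
  obtain ⟨y, hy, hxy⟩ := hS x
  exact ⟨y, hy, hU (by rw [mem_ball']; exact hxy.trans_lt hr)⟩

/-- Every nonempty open set contains, for all large `n`, a point fixed by `f^n`. -/
theorem LargePeriods.exists_periodic_mem {X : Type*} [MetricSpace X] {f : X ≃ₜ X}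
    (h : LargePeriods f) {U : Set X} (hU : IsOpen U) (hne : U.Nonempty) :
    ∃ N₀ : ℕ, ∀ n ≥ N₀, ∃ q ∈ U, (⇑f)^[n] q = q := by
  obtain ⟨x, hx⟩ := hne
  obtain ⟨r, hr, hball⟩ := isOpen_iff.1 hU x hx
  obtain ⟨N₀, hN⟩ := h (r / 2) (half_pos hr)
  refine ⟨N₀, fun n hn => ?_⟩
  obtain ⟨p, hp, hdense⟩ := hN n hn
  obtain ⟨q, hq, hqU⟩ := hdense.exists_mem_of_ball_subset (half_lt_self hr) hball
  exact ⟨q, hqU, iterate_eq_self_of_mem_orbitZ hp hq⟩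

/-- Two nonempty open sets are joined by an orbit segment, in one direction or the other. -/
theorem LargePeriods.exists_iterate_mem_or {X : Type*} [MetricSpace X] {f : X ≃ₜ X}
    (h : LargePeriods f) {U V : Set X} (hU : IsOpen U) (hV : IsOpen V)
    (hUne : U.Nonempty) (hVne : V.Nonempty) :
    ∃ j : ℕ, (U ∩ (⇑f)^[j] ⁻¹' V).Nonempty ∨ (V ∩ (⇑f)^[j] ⁻¹' U).Nonempty := by
  obtain ⟨x, hx⟩ := hUne
  obtain ⟨r, hr, hballU⟩ := isOpen_iff.1 hU x hx
  obtain ⟨x', hx'⟩ := hVne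
  obtain ⟨s, hs, hballV⟩ := isOpen_iff.1 hV x' hx'
  obtain ⟨ε, hε, hεrs⟩ := exists_between (lt_min hr hs)
  obtain ⟨N₀, hN⟩ := h ε hε
  obtain ⟨p, -, hdense⟩ := hN N₀ le_rfl
  obtain ⟨y, hy, hyU⟩ := hdense.exists_mem_of_ball_subset (hεrs.trans_le (min_le_left _ _)) hballU
  obtain ⟨z, hz, hzV⟩ := hdense.exists_mem_of_ball_subset (hεrs.trans_le (min_le_right _ _)) hballV
  obtain ⟨j, rfl | rfl⟩ := exists_iterate_eq_or_of_mem_orbitZ hy hz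
  · exact ⟨j, .inl ⟨y, hyU, hzV⟩⟩
  · exact ⟨j, .inr ⟨z, hzV, hyU⟩⟩

/-- Every homeomorphism of a metric space with the large periods property is
topologically mixing. -/
theorem largePeriods_implies_mixing {X : Type*} [MetricSpace X] (f : X ≃ₜ X)
    (h : LargePeriods f) :
    ∀ U V : Set X, IsOpen U → IsOpen V → U.Nonempty → V.Nonempty →
      ∃ N₀ : ℕ, ∀ n ≥ N₀, ((⇑f)^[n] '' U ∩ V).Nonempty := by
  intro U V hU hV hUne hVne
  obtain ⟨j, hj | hj⟩ := h.exists_iterate_mem_or hU hV hUne hVne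
  · obtain ⟨N₀, hN⟩ := h.exists_periodic_mem (hU.inter (hV.preimage (f.continuous.iterate j))) hj
    refine ⟨N₀ + j, fun n hn => ?_⟩
    obtain ⟨q, ⟨hqU, hqV⟩, hq⟩ := hN (n - j) (by omega)
    refine ⟨_, ⟨q, hqU, rfl⟩, ?_⟩
    rwa [← Nat.add_sub_cancel' (show j ≤ n by omega), Function.iterate_add_apply, hq]
  · obtain ⟨N₀, hN⟩ := h.exists_periodic_mem (hV.inter (hU.preimage (f.continuous.iterate j))) hj
    refine ⟨N₀, fun n hn => ?_⟩
    obtain ⟨q, ⟨hqV, hqU⟩, hq⟩ := hN (n + j) (by omega)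
    refine ⟨_, ⟨_, hqU, rfl⟩, ?_⟩
    rwa [← Function.iterate_add_apply, hq]
end

section
/- Every homeomorphism of a metric space with the large periods property is topologically transitive; that is, for every pair of nonempty open sets U, V ⊆ X there exists n > 0 such that f^n(U) ∩ V ≠ ∅. -/
open Metric Filter

/-- Two points on the orbit of a periodic point of a permutation are related by a positive
iterate. -/
theorem Equiv.Perm.exists_pos_iterate_zpow_eq {α : Type*} (g : Equiv.Perm α) {n : ℕ} (hn : 0 < n)
    {p : α} (hp : g^[n] p = p) (a b : ℤ) :
    ∃ m : ℕ, 0 < m ∧ g^[m] ((g ^ a) p) = (g ^ b) p := by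
  have hpos : 0 < b - a + n * (|b - a| + 1) := by
    have hn' : (1 : ℤ) ≤ n := by exact_mod_cast hn
    nlinarith [neg_abs_le (b - a), abs_nonneg (b - a)]
  obtain ⟨m, hm⟩ := Int.eq_ofNat_of_zero_le hpos.le
  refine ⟨m, by omega, ?_⟩
  have hfix : (g ^ (n : ℤ)) p = p := by
    rwa [zpow_natCast, ← Equiv.Perm.iterate_eq_pow]
  rw [Equiv.Perm.iterate_eq_pow, ← zpow_natCast, ← Equiv.Perm.mul_apply, ← zpow_add, ← hm,
    show b - a + n * (|b - a| + 1) + a = b + n * (|b - a| + 1) by ring, zpow_add, zpow_mul,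
    Equiv.Perm.mul_apply, Equiv.Perm.zpow_apply_eq_self_of_apply_eq_self hfix]

/-- Every homeomorphism of a metric space with the large periods property is
topologically transitive: for every pair of nonempty open sets `U`, `V` there is
`n > 0` with `f^n(U) ∩ V ≠ ∅`. -/
theorem largePeriods_implies_transitive {X : Type*} [MetricSpace X] (f : X ≃ₜ X)
    (h : LargePeriods f) :
    ∀ U V : Set X, IsOpen U → IsOpen V → U.Nonempty → V.Nonempty →
      ∃ n : ℕ, 0 < n ∧ ((⇑f)^[n] '' U ∩ V).Nonempty := by
  rintro U V hU hV ⟨u, hu⟩ ⟨v, hv⟩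
  obtain ⟨r, hr, hrU⟩ := Metric.nhds_basis_closedBall.mem_iff.1 (hU.mem_nhds hu)
  obtain ⟨s, hs, hsV⟩ := Metric.nhds_basis_closedBall.mem_iff.1 (hV.mem_nhds hv)
  obtain ⟨N, hN⟩ := h (min r s) (lt_min hr hs)
  obtain ⟨p, hp, hdense⟩ := hN (N + 1) N.le_succ
  obtain ⟨_, ⟨a, rfl⟩, ha⟩ := hdense u
  obtain ⟨_, ⟨b, rfl⟩, hb⟩ := hdense v
  obtain ⟨m, hm, hab⟩ :=
    Equiv.Perm.exists_pos_iterate_zpow_eq f.toEquiv N.succ_pos hp a b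
  refine ⟨m, hm, _, ⟨_, hrU ?_, hab⟩, hsV ?_⟩
  · exact Metric.mem_closedBall'.2 (ha.trans (min_le_left r s))
  · exact Metric.mem_closedBall'.2 (hb.trans (min_le_right r s))
end

section
/- Let f : X → X be a homeomorphism of a metric space (X,d), let p ∈ X satisfy f^τ(p) = p for some integer τ ≥ 1, and let q ∈ X be a point not lying on the orbit {f^k(p) : k ∈ ℤ} of p such that d(f^m(q), f^m(p)) → 0 as m → +∞ and d(f^{-m}(q), f^{-m+1}(p)) → 0 as m → +∞ (i.e., q is forward asymptotic to the orbit of p and backward asymptotic to the orbit of f(p)). Set O = {f^k(p) : k ∈ ℤ} ∪ {f^k(q) : k ∈ ℤ}. Then for every ε > 0 and every δ > 0 there exists N₀ ∈ ℕ such that for every n ≥ N₀ there is a periodic δ-pseudo-orbit (x_i)_{i∈ℤ} of f whose period is exactly n (that is, x_{i+n} = x_i for all i, n is the smallest positive integer with this property, and d(f(x_i), x_{i+1}) < δ for all i) such that every x_i lies within distance ε of the set O and every point of O lies within distance ε of some x_i. -/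
open Metric Filter

/-- Follow `Q` from time `-W` for `c` steps, then follow `P`. -/
def splice {X : Type*} (P Q : ℤ → X) (W c j : ℤ) : X :=
  if j < c then Q (j - W) else P (j - W)

theorem Int.add_one_emod_cases (x : ℤ) {L : ℤ} (hL : 0 < L) :
    (x + 1) % L = x % L + 1 ∨ ((x + 1) % L = 0 ∧ x % L = L - 1) := by
  have h : (x + 1) % L = (x % L + 1) % L := by simp
  have h0 := Int.emod_nonneg x hL.ne'
  have h1 := Int.emod_lt_of_pos x hL
  by_cases h2 : x % L + 1 < L
  · left
    rw [h, Int.emod_eq_of_lt (by omega) h2]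
  · right
    have h3 : x % L + 1 = L := by omega
    exact ⟨by rw [h, h3, Int.emod_self], by omega⟩

section Splice

variable {X : Type*} [MetricSpace X] {f : X → X} {P Q : ℤ → X} {τ W : ℤ} {η : ℝ}

theorem dist_splice_succ_lt (hη : 0 < η) (hfP : ∀ k, f (P k) = P (k + 1))
    (hfQ : ∀ k, f (Q k) = Q (k + 1)) (hfwd : ∀ k, W ≤ k → dist (Q k) (P k) < η)
    {c : ℤ} (hc : 2 * W ≤ c) (j : ℤ) :
    dist (f (splice P Q W c j)) (splice P Q W c (j + 1)) < η := by
  have e : j - W + 1 = j + 1 - W := by ring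
  unfold splice
  by_cases h1 : j + 1 < c
  · rw [if_pos (by omega), if_pos h1, hfQ, e, dist_self]
    exact hη
  · by_cases h2 : j < c
    · rw [if_pos h2, if_neg h1, hfQ, e]
      exact hfwd _ (by omega)
    · rw [if_neg h2, if_neg h1, hfP, e, dist_self]
      exact hη

theorem dist_splice_close_lt (hfP : ∀ k, f (P k) = P (k + 1))
    (hP : ∀ k z, P (k + τ * z) = P k) (hbwd : ∀ k, k ≤ -W → dist (Q k) (P (k + 1)) < η)
    {c c' j z : ℤ} (hc : c ≤ j) (hc' : 0 < c') (hj : j = τ * z) :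
    dist (f (splice P Q W c j)) (splice P Q W c' 0) < η := by
  unfold splice
  rw [if_neg (by omega), if_pos hc', hfP, dist_comm, zero_sub]
  have e : j - W + 1 = -W + 1 + τ * z := by rw [hj]; ring
  rw [e, hP]
  exact hbwd _ le_rfl

/-- If a periodic trajectory `P` and an injective trajectory `Q` disjoint from it satisfy that
`Q` is eventually close to `P` in the future and to the shift of `P` in the past, then following
`Q` repeatedly and waiting on `P` in between yields pseudo-orbits of every large period. -/
theorem exists_periodic_pseudo_orbit_of_homoclinic (hη : 0 < η) (hτ : 1 ≤ τ) (hW : 1 ≤ W)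
    (hfP : ∀ k, f (P k) = P (k + 1)) (hfQ : ∀ k, f (Q k) = Q (k + 1))
    (hP : ∀ k z, P (k + τ * z) = P k) (hQ : Function.Injective Q) (hPQ : ∀ k l, P k ≠ Q l)
    (hfwd : ∀ k, W ≤ k → dist (Q k) (P k) < η)
    (hbwd : ∀ k, k ≤ -W → dist (Q k) (P (k + 1)) < η)
    {n : ℤ} (hn : τ * (1 + τ * (2 * W)) + 2 * W + τ + 2 ≤ n) :
    ∃ x : ℤ → X, (∀ i, x (i + n) = x i) ∧
      (∀ m, 0 < m → m < n → ¬ ∀ i, x (i + m) = x i) ∧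
      (∀ i, dist (f (x i)) (x (i + 1)) < η) ∧
      (∀ i, x i ∈ Set.range P ∪ Set.range Q) ∧
      (∀ y ∈ Set.range P ∪ Set.range Q, ∃ i, dist (x i) y < η) := by
  obtain ⟨L, hL⟩ : ∃ L, L = 1 + τ * (2 * W) := ⟨_, rfl⟩
  obtain ⟨s, hs⟩ : ∃ s, s = (n - 1) % τ := ⟨_, rfl⟩
  obtain ⟨A, hA⟩ : ∃ A, A = n - s * L := ⟨_, rfl⟩
  have hs0 : 0 ≤ s := hs ▸ Int.emod_nonneg _ (by omega)
  have hs1 : s < τ := hs ▸ Int.emod_lt_of_pos _ (by omega)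
  have hLW : 2 * W + 1 ≤ L := by nlinarith
  have hLpos : 0 < L := by omega
  have hsL0 : 0 ≤ s * L := by positivity
  have hsL : s * L ≤ τ * L := by nlinarith
  have hAn : A ≤ n := by omega
  have hAlow : 2 * W + τ + 2 ≤ A := by rw [← hL] at hn; omega
  have hAmod : A - 1 = τ * ((n - 1) / τ - s * (2 * W)) := by
    have := Int.emod_add_mul_ediv (n - 1) τ
    rw [← hs] at this
    rw [hA, hL]
    linear_combination -this
  have hLmod : L - 1 = τ * (2 * W) := by omega
  let J : ℤ → ℤ := fun a => if a < A then a else (a - A) % L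
  let C : ℤ → ℤ := fun a => if a < A then 2 * W + 1 else 2 * W
  let Y : ℤ → X := fun a => splice P Q W (C a) (J a)
  have hYlt : ∀ a, a < A → Y a = splice P Q W (2 * W + 1) a := fun a ha => by
    simp only [Y, J, C, if_pos ha]
  have hYge : ∀ a, A ≤ a → Y a = splice P Q W (2 * W) ((a - A) % L) := fun a ha => by
    simp only [Y, J, C, if_neg (not_lt.2 ha)]
  have hYQ : ∀ k, -W ≤ k → k ≤ W → Y (k + W) = Q k := fun k h1 h2 => by
    rw [hYlt _ (by omega), splice, if_pos (by omega), add_sub_cancel_right]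
  have hYuniq : ∀ a, Y a = Q W → a = 2 * W := by
    intro a ha
    by_cases h : a < A
    · rw [hYlt a h, splice] at ha
      split_ifs at ha
      · have := hQ ha
        omega
      · exact absurd ha (hPQ _ _)
    · rw [hYge a (not_lt.1 h), splice] at ha
      split_ifs at ha
      · have := hQ ha
        omega
      · exact absurd ha (hPQ _ _)
  have hclose : ∀ c : ℤ, 0 < c → ∀ a, (J a = A - 1 ∧ a < A ∨ J a = L - 1 ∧ A ≤ a) →
      dist (f (Y a)) (splice P Q W c 0) < η := by
    rintro c hc a (⟨h, ha⟩ | ⟨h, ha⟩)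
    · refine dist_splice_close_lt hfP hP hbwd ?_ hc (h.trans hAmod)
      simp only [C, if_pos ha, h]
      omega
    · refine dist_splice_close_lt hfP hP hbwd ?_ hc (h.trans hLmod)
      simp only [C, if_neg (not_lt.2 ha), h]
      omega
  have hY0 : Y 0 = splice P Q W (2 * W + 1) 0 := hYlt 0 (by omega)
  have hstep : ∀ a, 0 ≤ a → a + 1 < n → dist (f (Y a)) (Y (a + 1)) < η := by
    intro a ha han
    rcases lt_trichotomy (a + 1) A with h | h | h
    · rw [hYlt a (by omega), hYlt _ h]
      exact dist_splice_succ_lt hη hfP hfQ hfwd (by omega) a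
    · rw [hYge (a + 1) h.ge, h, sub_self, Int.zero_emod]
      refine hclose _ (by omega) a (Or.inl ⟨?_, by omega⟩)
      simp only [J, if_pos (show a < A by omega)]
      omega
    · have e : a + 1 - A = a - A + 1 := by ring
      rw [hYge (a + 1) h.le, e]
      rcases Int.add_one_emod_cases (a - A) hLpos with h1 | ⟨h1, h2⟩
      · rw [h1, hYge a (by omega)]
        exact dist_splice_succ_lt hη hfP hfQ hfwd le_rfl _
      · rw [h1]
        refine hclose _ (by omega) a (Or.inr ⟨?_, by omega⟩)
        simp only [J, if_neg (show ¬ a < A by omega), h2]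
  have hlast : dist (f (Y (n - 1))) (Y 0) < η := by
    rw [hY0]
    refine hclose _ (by omega) _ ?_
    by_cases h : n - 1 < A
    · refine Or.inl ⟨?_, h⟩
      simp only [J, if_pos h]
      omega
    · refine Or.inr ⟨?_, by omega⟩
      simp only [J, if_neg h]
      have e : n - 1 - A = (L - 1) + L * (s - 1) := by rw [hA]; ring
      rw [e, Int.add_mul_emod_self_left, Int.emod_eq_of_lt (by omega) (by omega)]
  have hnpos : 0 < n := by omega
  have hx : ∀ a, 0 ≤ a → a < n → Y (a % n) = Y a := fun a h1 h2 => by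
    rw [Int.emod_eq_of_lt h1 h2]
  refine ⟨fun i => Y (i % n), ?_, ?_, ?_, ?_, ?_⟩
  · intro i
    simp
  · intro m hm hmn h
    have h1 := h (2 * W)
    simp only at h1
    have e : Y (2 * W) = Q W := by rw [two_mul]; exact hYQ W (by omega) le_rfl
    rw [hx (2 * W) (by omega) (by omega), e] at h1
    have h2 := hYuniq _ h1
    have h3 : (2 * W + m) % n = (2 * W) % n := by
      rw [h2, Int.emod_eq_of_lt (by omega) (by omega)]
    have h5 : n ∣ m := by
      have := Int.ModEq.dvd (show (2 * W) ≡ 2 * W + m [ZMOD n] from h3.symm)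
      simpa using this
    have := Int.le_of_dvd hm h5
    omega
  · intro i
    have h0 := Int.emod_nonneg i hnpos.ne'
    have h1 := Int.emod_lt_of_pos i hnpos
    rcases Int.add_one_emod_cases i hnpos with h | ⟨h, h'⟩
    · simp only [h]
      exact hstep _ h0 (by have := Int.emod_lt_of_pos (i + 1) hnpos; omega)
    · simp only [h, h']
      exact hlast
  · intro i
    simp only [Y, splice]
    split_ifs
    · exact Or.inr ⟨_, rfl⟩
    · exact Or.inl ⟨_, rfl⟩
  · have hcover : ∀ k, ∃ i, Y (i % n) = P k := by
      intro k
      have h0 := Int.emod_nonneg (k - (W + 1)) (show τ ≠ 0 by omega)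
      have h1 := Int.emod_lt_of_pos (k - (W + 1)) (show 0 < τ by omega)
      have h2 := Int.emod_add_mul_ediv (k - (W + 1)) τ
      refine ⟨2 * W + 1 + (k - (W + 1)) % τ, ?_⟩
      rw [hx _ (by omega) (by omega), hYlt _ (by omega), splice, if_neg (by omega),
        ← hP _ ((k - (W + 1)) / τ)]
      congr 1
      linear_combination h2
    rintro y (⟨k, rfl⟩ | ⟨k, rfl⟩)
    · obtain ⟨i, hi⟩ := hcover k
      exact ⟨i, by simpa [hi] using hη⟩
    · rcases lt_or_ge k (-W) with h | h
      · obtain ⟨i, hi⟩ := hcover (k + 1)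
        refine ⟨i, ?_⟩
        simp only [hi]
        rw [dist_comm]
        exact hbwd k h.le
      · rcases le_or_gt k W with h' | h'
        · refine ⟨k + W, ?_⟩
          simp only [hx (k + W) (by omega) (by omega), hYQ k h h', dist_self]
          exact hη
        · obtain ⟨i, hi⟩ := hcover k
          refine ⟨i, ?_⟩
          simp only [hi]
          rw [dist_comm]
          exact hfwd k h'.le

end Splice

section Orbit

variable {X : Type*} [MetricSpace X] (f : X ≃ₜ X)

theorem apply_zpow_toEquiv (x : X) (k : ℤ) :
    f ((f.toEquiv ^ k) x) = (f.toEquiv ^ (k + 1)) x := by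
  rw [add_comm, zpow_add, zpow_one, Equiv.Perm.mul_apply]
  rfl

theorem zpow_natCast_toEquiv_apply (x : X) (m : ℕ) :
    (f.toEquiv ^ (m : ℤ)) x = (⇑f)^[m] x := by
  rw [zpow_natCast, ← Equiv.Perm.iterate_eq_pow]
  rfl

theorem zpow_toEquiv_add_mul {x : X} {t : ℤ} (h : (f.toEquiv ^ t) x = x) (k z : ℤ) :
    (f.toEquiv ^ (k + t * z)) x = (f.toEquiv ^ k) x := by
  rw [zpow_add, Equiv.Perm.mul_apply, zpow_mul,
    Equiv.Perm.zpow_apply_eq_self_of_apply_eq_self h]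

/-- A point forward asymptotic to a periodic orbit, but off it, is not periodic. -/
theorem injective_zpow_of_asymptotic {p q : X} {τ : ℕ} (hτ : 1 ≤ τ)
    (hp : (f.toEquiv ^ (τ : ℤ)) p = p) (hpq : q ≠ p)
    (hfwd : Tendsto (fun m : ℕ => dist ((⇑f)^[m] q) ((⇑f)^[m] p)) atTop (nhds 0)) :
    Function.Injective (fun k : ℤ => (f.toEquiv ^ k) q) := by
  have key : ∀ a b : ℤ, a < b → (f.toEquiv ^ a) q ≠ (f.toEquiv ^ b) q := by
    intro a b hab h
    obtain ⟨T, hT⟩ : ∃ T : ℕ, b = a + T := ⟨(b - a).toNat, by omega⟩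
    have hTpos : 0 < T := by omega
    rw [hT, zpow_add, Equiv.Perm.mul_apply] at h
    have hq : (f.toEquiv ^ (T : ℤ)) q = q := ((f.toEquiv ^ a).injective h).symm
    have hmul : Tendsto (fun m : ℕ => τ * T * m) atTop atTop :=
      tendsto_id.const_mul_atTop' (by positivity)
    have hconst : ∀ m : ℕ, dist ((⇑f)^[τ * T * m] q) ((⇑f)^[τ * T * m] p) = dist q p := by
      intro m
      rw [← zpow_natCast_toEquiv_apply, ← zpow_natCast_toEquiv_apply]
      have e1 : ((τ * T * m : ℕ) : ℤ) = 0 + T * (τ * m) := by push_cast; ring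
      have e2 : ((τ * T * m : ℕ) : ℤ) = 0 + τ * (T * m) := by push_cast; ring
      have h1 := zpow_toEquiv_add_mul f hq 0 (τ * m)
      have h2 := zpow_toEquiv_add_mul f hp 0 (T * m)
      rw [← e1] at h1
      rw [← e2] at h2
      rw [h1, h2]
      rfl
    have hlim := hfwd.comp hmul
    have : Tendsto (fun _ : ℕ => dist q p) atTop (nhds 0) := hlim.congr hconst
    exact hpq (dist_eq_zero.1 (tendsto_nhds_unique tendsto_const_nhds this))
  intro a b h
  rcases lt_trichotomy a b with hab | hab | hab
  · exact absurd h (key a b hab)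
  · exact hab
  · exact absurd h.symm (key b a hab)

end Orbit

/-- Given a periodic point `p` of period `τ ≥ 1` and a point `q` off the orbit of `p`
which is forward asymptotic to the orbit of `p` and backward asymptotic to the orbit
of `f(p)`, for all `ε, δ > 0` there is `N₀` such that for every `n ≥ N₀` there is a
periodic `δ`-pseudo-orbit of period exactly `n` lying within Hausdorff distance `ε`
of `O = orbit(p) ∪ orbit(q)`. -/
theorem pseudo_orbits_of_all_large_periods {X : Type*} [MetricSpace X] (f : X ≃ₜ X)
    (p q : X) (τ : ℕ) (hτ : 1 ≤ τ) (hp : (⇑f)^[τ] p = p)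
    (hq : q ∉ orbitZ f p)
    (hfwd : Tendsto (fun m : ℕ => dist ((⇑f)^[m] q) ((⇑f)^[m] p)) atTop (nhds 0))
    (hbwd : Tendsto (fun m : ℕ =>
      dist ((f.toEquiv ^ (-(m : ℤ))) q) ((f.toEquiv ^ (1 - (m : ℤ))) p)) atTop (nhds 0)) :
    ∀ ε > (0 : ℝ), ∀ δ > (0 : ℝ), ∃ N₀ : ℕ, ∀ n ≥ N₀, ∃ x : ℤ → X,
      0 < n ∧
      (∀ i : ℤ, x (i + (n : ℤ)) = x i) ∧
      (∀ m : ℕ, 0 < m → m < n → ¬ (∀ i : ℤ, x (i + (m : ℤ)) = x i)) ∧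
      (∀ i : ℤ, dist (f (x i)) (x (i + 1)) < δ) ∧
      (∀ i : ℤ, ∃ y ∈ orbitZ f p ∪ orbitZ f q, dist (x i) y ≤ ε) ∧
      (∀ y ∈ orbitZ f p ∪ orbitZ f q, ∃ i : ℤ, dist (x i) y ≤ ε) := by
  intro ε hε δ hδ
  have hη : 0 < min ε δ := lt_min hε hδ
  have hp' : (f.toEquiv ^ (τ : ℤ)) p = p := by rw [zpow_natCast_toEquiv_apply, hp]
  have hpq : q ≠ p := fun h => hq ⟨0, by simp [h]⟩
  obtain ⟨W₁, hW₁⟩ := eventually_atTop.1 (hfwd.eventually_lt_const hη)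
  obtain ⟨W₂, hW₂⟩ := eventually_atTop.1 (hbwd.eventually_lt_const hη)
  let W : ℕ := max 1 (max W₁ W₂)
  have hfwd' : ∀ k : ℤ, (W : ℤ) ≤ k →
      dist ((f.toEquiv ^ k) q) ((f.toEquiv ^ k) p) < min ε δ := by
    intro k hk
    obtain ⟨m, rfl⟩ : ∃ m : ℕ, k = m := ⟨k.toNat, by omega⟩
    rw [zpow_natCast_toEquiv_apply, zpow_natCast_toEquiv_apply]
    exact hW₁ m (by omega)
  have hbwd' : ∀ k : ℤ, k ≤ -(W : ℤ) →
      dist ((f.toEquiv ^ k) q) ((f.toEquiv ^ (k + 1)) p) < min ε δ := by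
    intro k hk
    obtain ⟨m, rfl⟩ : ∃ m : ℕ, k = -(m : ℤ) := ⟨(-k).toNat, by omega⟩
    rw [neg_add_eq_sub]
    exact hW₂ m (by omega)
  have hPQ : ∀ k l : ℤ, (f.toEquiv ^ k) p ≠ (f.toEquiv ^ l) q := by
    intro k l h
    refine hq ⟨-l + k, ?_⟩
    rw [zpow_add, Equiv.Perm.mul_apply, h, ← Equiv.Perm.mul_apply, ← zpow_add]
    simp
  refine ⟨τ * (1 + τ * (2 * W)) + 2 * W + τ + 2, fun n hn => ?_⟩
  obtain ⟨x, h1, h2, h3, h4, h5⟩ := exists_periodic_pseudo_orbit_of_homoclinic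
    (f := f) (τ := τ) (W := W) (n := n) hη (by exact_mod_cast hτ) (by omega)
    (apply_zpow_toEquiv f p) (apply_zpow_toEquiv f q) (zpow_toEquiv_add_mul f hp')
    (injective_zpow_of_asymptotic f hτ hp' hpq hfwd) hPQ hfwd' hbwd' (by exact_mod_cast hn)
  refine ⟨x, by omega, h1, fun m hm hmn => h2 m (by exact_mod_cast hm) (by exact_mod_cast hmn),
    fun i => (h3 i).trans_le (min_le_right _ _), fun i => ⟨x i, h4 i, by simpa using hε.le⟩,
    fun y hy => ?_⟩
  obtain ⟨i, hi⟩ := h5 y hy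
  exact ⟨i, hi.le.trans (min_le_left _ _)⟩
end
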